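/- Let W be the Weyl group of type C_{n+1}, P = P_k the maximal parabolic subgroup omitting the simple reflection s_k (1 < k ≤ n+1). Identify minimal length representatives w ∈ W^P with increasing sequences (w(1) < w(2) < ⋯ < w(k)) in {1,...,2n+2} (with order 1 < 2 < ⋯ < n+1 < \overline{n+1} < ⋯ < \overline{1}, \overline{i} = 2n+3-i) containing no pair {i, \overline{i}}. Let z̄_1 = (2 < 3 < ⋯ < k < \overline{1}) be the minimal representative of s_{2t_1}W_P. Then for w ∈ W^P, ℓ(w · z_1 W_P) = ℓ(w) + ℓ(z_1 W_P) if and only if w(1) = 1. -/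

import Mathlib

def bar (n : ℕ) (i : Fin (2*n+2)) : Fin (2*n+2) := ⟨2*n+1 - i, by have := i.isLt; omega⟩

def IsSigned (n : ℕ) (w : Equiv.Perm (Fin (2*n+2))) : Prop :=
  ∀ i, w (bar n i) = bar n (w i)

def IsOddSymp (n : ℕ) (w : Equiv.Perm (Fin (2*n+2))) : Prop :=
  ∀ j : Fin (2*n+2), (j : ℕ) < n+1 → (w j : ℕ) ≠ 2*n+1

def sgen (n : ℕ) (i : Fin (n+1)) : Equiv.Perm (Fin (2*n+2)) :=
  if h : (i : ℕ) < n then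
    (Equiv.swap ⟨i, by omega⟩ ⟨(i : ℕ)+1, by omega⟩) *
      (Equiv.swap ⟨2*n - i, by omega⟩ ⟨2*n+1 - i, by omega⟩)
  else Equiv.swap ⟨n, by omega⟩ ⟨n+1, by omega⟩

noncomputable def len (n : ℕ) (w : Equiv.Perm (Fin (2*n+2))) : ℕ :=
  sInf {m | ∃ l : List (Fin (n+1)), l.length = m ∧ (l.map (sgen n)).prod = w}

def WP (n k : ℕ) : Subgroup (Equiv.Perm (Fin (2*n+2))) :=
  Subgroup.closure {x | ∃ i : Fin (n+1), (i : ℕ) ≠ k - 1 ∧ x = sgen n i}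

noncomputable def IsMinRep (n k : ℕ) (w : Equiv.Perm (Fin (2*n+2))) : Prop :=
  ∀ p ∈ WP n k, len n w ≤ len n (w * p)

noncomputable def cosetLen (n k : ℕ) (w : Equiv.Perm (Fin (2*n+2))) : ℕ :=
  sInf {m | ∃ p ∈ WP n k, len n (w * p) = m}

def s2t1 (n : ℕ) : Equiv.Perm (Fin (2*n+2)) := Equiv.swap ⟨0, by omega⟩ ⟨2*n+1, by omega⟩

def st1t2 (n : ℕ) : Equiv.Perm (Fin (2*n+2)) :=
  Equiv.swap ⟨0, by omega⟩ ⟨2*n, by omega⟩ * Equiv.swap ⟨1, by omega⟩ ⟨2*n+1, by omega⟩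

section
open Finset

def z0 (n : ℕ) : Fin (2*n+2) := ⟨0, Nat.succ_pos _⟩

lemma z0_val (n : ℕ) : (z0 n : ℕ) = 0 := rfl

lemma bar_val (n : ℕ) (i : Fin (2*n+2)) : (bar n i : ℕ) = 2*n+1 - i := rfl

lemma bar_bar (n : ℕ) (i : Fin (2*n+2)) : bar n (bar n i) = i := by
  have := i.isLt
  ext; simp only [bar_val]; omega

lemma sgen_val (n : ℕ) (i : Fin (n+1)) (p : Fin (2*n+2)) :
    (sgen n i p : ℕ) = if (p:ℕ) = i then (i:ℕ)+1 else if (p:ℕ) = i+1 then (i:ℕ)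
      else if (p:ℕ) = 2*n - i then 2*n+1-i else if (p:ℕ) = 2*n+1-i then 2*n-i else p := by
  have hi := i.isLt
  have hp := p.isLt
  unfold sgen
  split_ifs with h <;>
  simp only [Equiv.Perm.mul_apply, Equiv.swap_apply_def, Fin.ext_iff] <;>
  repeat' split_ifs
  all_goals first | omega | (simp at *; done) | (simp at *; omega)

lemma sgen_signed (n : ℕ) (i : Fin (n+1)) : IsSigned n (sgen n i) := by
  intro p
  have hi := i.isLt
  have hp := p.isLt
  ext
  have h1 := sgen_val n i p
  have h2 := sgen_val n i (bar n p)
  rw [bar_val] at h2 ⊢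
  split_ifs at h1 <;> split_ifs at h2 <;> omega

lemma sgen_sq (n : ℕ) (i : Fin (n+1)) : sgen n i * sgen n i = 1 := by
  ext p
  have hi := i.isLt
  have hp := p.isLt
  simp only [Equiv.Perm.mul_apply, sgen_val, Equiv.Perm.one_apply]
  split_ifs <;> omega

lemma signed_mul {n : ℕ} {a b : Equiv.Perm (Fin (2*n+2))} (ha : IsSigned n a)
    (hb : IsSigned n b) : IsSigned n (a * b) := by
  intro i
  simp only [Equiv.Perm.mul_apply, hb i, ha _]

lemma signed_one (n : ℕ) : IsSigned n 1 := fun _ => rfl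

def InvS (n : ℕ) (w : Equiv.Perm (Fin (2*n+2))) : Finset (Fin (2*n+2) × Fin (2*n+2)) :=
  univ.filter (fun x => x.1 < x.2 ∧ w x.2 < w x.1)

def NegS (n : ℕ) (w : Equiv.Perm (Fin (2*n+2))) : Finset (Fin (2*n+2)) :=
  univ.filter (fun i => i < bar n i ∧ w (bar n i) < w i)

lemma mem_InvS {n : ℕ} {w : Equiv.Perm (Fin (2*n+2))} {p q : Fin (2*n+2)} :
    (p, q) ∈ InvS n w ↔ p < q ∧ w q < w p := by
  simp [InvS]

def LL (n : ℕ) (w : Equiv.Perm (Fin (2*n+2))) : ℕ := (InvS n w).card + (NegS n w).card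

/-- ascent at position `i` -/
def Asc (n : ℕ) (w : Equiv.Perm (Fin (2*n+2))) (i : ℕ) : Prop :=
  ∀ p q : Fin (2*n+2), (p:ℕ) = i → (q:ℕ) = i+1 → w p < w q

lemma asc_bar {n : ℕ} {w : Equiv.Perm (Fin (2*n+2))} (hw : IsSigned n w) {i : ℕ}
    (hi : i ≤ 2*n) (h : Asc n w i) : Asc n w (2*n - i) := by
  intro p q hp hq
  have := h (bar n q) (bar n p) (by rw [bar_val]; omega) (by rw [bar_val]; omega)
  rw [hw, hw, Fin.lt_def, bar_val, bar_val] at this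
  rw [Fin.lt_def]
  omega

lemma LL_asc {n : ℕ} {w : Equiv.Perm (Fin (2*n+2))} (hw : IsSigned n w) (i : Fin (n+1))
    (h : Asc n w i) : LL n (w * sgen n i) = LL n w + 2 := by
  have hi := i.isLt
  have h' := asc_bar hw (by omega) h
  set s := sgen n i with hs
  have hv := sgen_val n i
  rw [← hs] at hv
  set M := (InvS n w).map (s.symm.prodCongr s.symm).toEmbedding with hM
  have hMc : M.card = (InvS n w).card := card_map _
  have hMm : ∀ x, x ∈ M ↔ s x.1 < s x.2 ∧ w (s x.2) < w (s x.1) := by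
    intro x
    rw [hM, mem_map_equiv]
    simp [InvS]
  set N := (NegS n w).map s.symm.toEmbedding with hN
  have hNc : N.card = (NegS n w).card := card_map _
  have hsb : ∀ x, s (bar n x) = bar n (s x) := sgen_signed n i
  have hNm : ∀ x, x ∈ N ↔ s x < bar n (s x) ∧ w (bar n (s x)) < w (s x) := by
    intro x
    rw [hN, mem_map_equiv]
    simp [NegS]
  have key : ∀ p q : Fin (2*n+2), ¬ ((p:ℕ) = i ∧ (q:ℕ) = i+1) → ¬ ((q:ℕ) = i ∧ (p:ℕ) = i+1) →
      ¬ ((p:ℕ) = 2*n-i ∧ (q:ℕ) = 2*n+1-i) → ¬ ((q:ℕ) = 2*n-i ∧ (p:ℕ) = 2*n+1-i) →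
      (p < q ↔ s p < s q) := by
    intro p q h1 h2 h3 h4
    have := p.isLt
    have := q.isLt
    simp only [Fin.lt_def, hv]
    split_ifs <;> omega
  let a : Fin (2*n+2) := ⟨i, by omega⟩
  let a' : Fin (2*n+2) := ⟨i+1, by omega⟩
  let b : Fin (2*n+2) := ⟨2*n-i, by omega⟩
  let b' : Fin (2*n+2) := ⟨2*n+1-i, by omega⟩
  have sa : s a = a' := by ext; rw [hv]; simp [a, a']
  have sa' : s a' = a := by ext; rw [hv]; simp [a, a']
  have sb : s b = b' := by ext; rw [hv]; simp only [b, b']; split_ifs <;> omega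
  have sb' : s b' = b := by ext; rw [hv]; simp only [b, b']; split_ifs <;> omega
  have laa : a < a' := by simp [a, a', Fin.lt_def]
  have lbb : b < b' := by simp only [b, b', Fin.lt_def]; omega
  have waa : w a < w a' := h a a' rfl rfl
  have wbb : w b < w b' := h' b b' rfl (by simp only [b']; omega)
  have hInv : InvS n (w * s) = insert (a, a') (insert (b, b') M) := by
    ext ⟨p, q⟩
    simp only [mem_insert, hMm, mem_InvS, Equiv.Perm.mul_apply, Prod.mk.injEq]
    by_cases h1 : p = a ∧ q = a'
    · obtain ⟨rfl, rfl⟩ := h1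
      simp [sa, sa', laa, waa]
    by_cases h2 : q = a ∧ p = a'
    · obtain ⟨rfl, rfl⟩ := h2
      simp only [sa, sa']
      have : ¬ (a' = b ∧ a = b') := by
        rintro ⟨e1, e2⟩
        rw [Fin.ext_iff] at e1 e2
        simp only [a, a', b, b'] at e1 e2
        omega
      simp [laa.not_gt, waa.not_gt, laa.ne', this]
    by_cases h3 : p = b ∧ q = b'
    · obtain ⟨rfl, rfl⟩ := h3
      simp [sb, sb', lbb, wbb]
    by_cases h4 : q = b ∧ p = b'
    · obtain ⟨rfl, rfl⟩ := h4
      simp only [sb, sb']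
      simp only [lbb.not_gt, wbb.not_gt, h1, false_and, and_false, h3, or_self]
    · simp only [h1, h3, false_or]
      rw [key p q]
      · simpa [Fin.ext_iff, a, a'] using h1
      · simpa [Fin.ext_iff, a, a'] using h2
      · simpa [Fin.ext_iff, b, b'] using h3
      · simpa [Fin.ext_iff, b, b'] using h4
  have ha : (a, a') ∉ M := by rw [hMm]; simp [sa, sa', waa.not_gt, laa.not_gt]
  have hb : (b, b') ∉ M := by rw [hMm]; simp [sb, sb', wbb.not_gt, lbb.not_gt]
  unfold LL
  by_cases hin : (i:ℕ) < n
  · have hne : (a, a') ∉ insert (b, b') M := by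
      rw [mem_insert]
      push Not
      refine ⟨?_, ha⟩
      simp only [ne_eq, Prod.mk.injEq, Fin.ext_iff, a, a', b, b']
      omega
    have hNeg : NegS n (w * s) = N := by
      ext p
      rw [hNm]
      simp only [NegS, mem_filter, mem_univ, true_and, Equiv.Perm.mul_apply, hsb]
      have : p < bar n p ↔ s p < bar n (s p) := by
        have := p.isLt
        simp only [Fin.lt_def, bar_val, hv]
        split_ifs <;> omega
      rw [this]
    rw [hInv, card_insert_of_notMem hne, card_insert_of_notMem hb, hNeg, hMc, hNc]
    omega
  · have e1 : b = a := by ext; simp only [a, b]; omega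
    have e2 : b' = a' := by ext; simp only [a', b']; omega
    have e3 : bar n a = a' := by ext; simp only [a', a, bar_val]; omega
    have e4 : bar n a' = a := by rw [← e3, bar_bar]
    have hNeg : NegS n (w * s) = insert a N := by
      ext p
      rw [mem_insert, hNm]
      simp only [NegS, mem_filter, mem_univ, true_and, Equiv.Perm.mul_apply, hsb]
      by_cases h1 : p = a
      · subst h1
        simp [sa, e3, e4, laa, waa]
      by_cases h2 : p = a'
      · subst h2
        simp [sa', e3, e4, laa.not_gt, waa.not_gt, laa.ne']
      · simp only [h1, false_or]
        have : p < bar n p ↔ s p < bar n (s p) := by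
          have := p.isLt
          simp only [a, a', Fin.ext_iff] at h1 h2
          simp only [Fin.lt_def, bar_val, hv]
          split_ifs <;> omega
        rw [this]
    have haN : a ∉ N := by rw [hNm]; simp [sa, e4, laa.not_gt]
    rw [hInv, e1, e2, insert_idem, card_insert_of_notMem ha, hNeg, card_insert_of_notMem haN,
      hMc, hNc]
    omega

lemma not_asc {n : ℕ} {w : Equiv.Perm (Fin (2*n+2))} {i : Fin (n+1)}
    (h : ¬ Asc n w i) : Asc n (w * sgen n i) i := by
  unfold Asc at h
  push Not at h
  obtain ⟨p, q, hp, hq, hle⟩ := h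
  intro p' q' hp' hq'
  have e1 : sgen n i p' = q := by ext; rw [sgen_val, if_pos hp', hq]
  have e2 : sgen n i q' = p := by
    ext; rw [sgen_val, if_neg (by omega), if_pos hq', hp]
  rw [Equiv.Perm.mul_apply, Equiv.Perm.mul_apply, e1, e2]
  refine lt_of_le_of_ne hle ?_
  intro e
  have := w.injective e
  rw [this] at hq
  omega

lemma LL_desc {n : ℕ} {w : Equiv.Perm (Fin (2*n+2))} (hw : IsSigned n w) (i : Fin (n+1))
    (h : ¬ Asc n w i) : LL n (w * sgen n i) + 2 = LL n w := by
  have := LL_asc (signed_mul hw (sgen_signed n i)) i (not_asc h)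
  rw [mul_assoc, sgen_sq, mul_one] at this
  exact this.symm

lemma LL_one (n : ℕ) : LL n 1 = 0 := by
  unfold LL InvS NegS
  rw [Finset.filter_false_of_mem, Finset.filter_false_of_mem]
  · simp
  · intro x _ ⟨h1, h2⟩
    exact absurd h1 h2.not_gt
  · intro x _ ⟨h1, h2⟩
    exact absurd h1 h2.not_gt

/-- if there is no wall in between, `w` is increasing. -/
lemma mono_of_asc {n : ℕ} {w : Equiv.Perm (Fin (2*n+2))} (P : ℕ → Prop)
    (h : ∀ i, i ≤ 2*n → P i → Asc n w i) (p q : Fin (2*n+2)) (hpq : p < q)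
    (hP : ∀ i, (p:ℕ) ≤ i → i < q → P i) : w p < w q := by
  obtain ⟨q, hq⟩ := q
  induction q with
  | zero => simp [Fin.lt_def] at hpq
  | succ m ih =>
    have hm : w ⟨m, by omega⟩ < w ⟨m+1, hq⟩ :=
      h m (by omega) (hP m (by rw [Fin.lt_def] at hpq; simp at hpq; omega) (by simp)) _ _ rfl rfl
    rw [Fin.lt_def] at hpq
    simp only at hpq
    by_cases e : (p:ℕ) = m
    · have : p = ⟨m, by omega⟩ := Fin.ext e
      rw [this]; exact hm
    · refine lt_trans (ih (by omega) (by rw [Fin.lt_def]; simp only; omega) ?_) hm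
      intro i h1 h2
      exact hP i h1 (by simp only at *; omega)

lemma asc_all {n : ℕ} {w : Equiv.Perm (Fin (2*n+2))} (hw : IsSigned n w) (k : ℕ)
    (h : ∀ i : Fin (n+1), (i:ℕ) ≠ k → Asc n w i) (i : ℕ) (hi : i ≤ 2*n)
    (h1 : i ≠ k) (h2 : 2*n - i ≠ k) : Asc n w i := by
  by_cases hin : i ≤ n
  · exact h ⟨i, by omega⟩ h1
  · have := asc_bar hw (by omega) (h ⟨2*n - i, by omega⟩ h2)
    simp only at this
    rwa [show 2*n - (2*n - i) = i by omega] at this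

lemma perm_eq_id {m : ℕ} {w : Equiv.Perm (Fin m)} (h : StrictMono w) : ⇑w = id := by
  have e : (h.orderIsoOfSurjective w w.surjective) = OrderIso.refl _ := Subsingleton.elim _ _
  funext x
  exact congrArg (fun f => f x) e

lemma exists_word {n : ℕ} (m : ℕ) : ∀ w : Equiv.Perm (Fin (2*n+2)), IsSigned n w → LL n w ≤ m →
    ∃ l : List (Fin (n+1)), 2 * l.length = LL n w ∧ (l.map (sgen n)).prod = w := by
  induction m with
  | zero =>
    intro w hw hm
    have hall : ∀ i : Fin (n+1), Asc n w i := by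
      intro i
      by_contra hc
      have := LL_desc hw i hc
      omega
    refine ⟨[], by simp; omega, ?_⟩
    have hmono : StrictMono w := by
      intro p q hpq
      refine mono_of_asc (fun _ => True) ?_ p q hpq (fun _ _ _ => trivial)
      intro i hi _
      exact asc_all hw (2*n+1) (fun i _ => hall i) i hi (by omega) (by omega)
    have : ⇑w = id := perm_eq_id hmono
    ext p
    simp [this]
  | succ m ih =>
    intro w hw hm
    by_cases hall : ∃ i : Fin (n+1), ¬ Asc n w i
    · obtain ⟨i, hi⟩ := hall
      have := LL_desc hw i hi
      obtain ⟨l, hl, hp⟩ := ih (w * sgen n i) (signed_mul hw (sgen_signed n i)) (by omega)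
      refine ⟨l ++ [i], by simp; omega, ?_⟩
      rw [List.map_append, List.prod_append, hp]
      simp [mul_assoc, sgen_sq]
    · push Not at hall
      refine ⟨[], ?_, ?_⟩
      all_goals
        have hmono : StrictMono w := by
          intro p q hpq
          refine mono_of_asc (fun _ => True) ?_ p q hpq (fun _ _ _ => trivial)
          intro i hi _
          exact asc_all hw (2*n+1) (fun i _ => hall i) i hi (by omega) (by omega)
        have : ⇑w = id := perm_eq_id hmono
        have hw1 : w = 1 := by
          ext p
          simp [this]
        subst hw1
        simp [LL_one]

lemma word_signed {n : ℕ} (l : List (Fin (n+1))) : IsSigned n (l.map (sgen n)).prod ∧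
    LL n (l.map (sgen n)).prod ≤ 2 * l.length := by
  induction l using List.reverseRecOn with
  | nil => exact ⟨signed_one n, by simp [LL_one]⟩
  | append_singleton l i ih =>
    obtain ⟨h1, h2⟩ := ih
    rw [List.map_append, List.prod_append]
    simp only [List.map_cons, List.map_nil, List.prod_singleton, List.length_append,
      List.length_singleton]
    refine ⟨signed_mul h1 (sgen_signed n i), ?_⟩
    by_cases h : Asc n (l.map (sgen n)).prod i
    · rw [LL_asc h1 i h]; omega
    · have := LL_desc h1 i h; omega

lemma len_eq {n : ℕ} {w : Equiv.Perm (Fin (2*n+2))} (hw : IsSigned n w) :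
    2 * len n w = LL n w := by
  obtain ⟨l, hl, hp⟩ := exists_word _ w hw le_rfl
  have h1 : len n w ≤ l.length := Nat.sInf_le ⟨l, rfl, hp⟩
  have h2 : len n w ∈ {m | ∃ l : List (Fin (n+1)), l.length = m ∧ (l.map (sgen n)).prod = w} :=
    Nat.sInf_mem ⟨_, l, rfl, hp⟩
  obtain ⟨l', e1, e2⟩ := h2
  have := (word_signed l').2
  rw [e2] at this
  omega

lemma len_asc {n : ℕ} {w : Equiv.Perm (Fin (2*n+2))} (hw : IsSigned n w) (i : Fin (n+1))
    (h : Asc n w i) : len n (w * sgen n i) = len n w + 1 := by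
  have h1 := LL_asc hw i h
  have h2 := len_eq hw
  have h3 := len_eq (signed_mul hw (sgen_signed n i))
  omega

lemma len_desc {n : ℕ} {w : Equiv.Perm (Fin (2*n+2))} (hw : IsSigned n w) (i : Fin (n+1))
    (h : ¬ Asc n w i) : len n (w * sgen n i) + 1 = len n w := by
  have h1 := LL_desc hw i h
  have h2 := len_eq hw
  have h3 := len_eq (signed_mul hw (sgen_signed n i))
  omega

lemma WP_spec {n k : ℕ} (hk : 2 ≤ k) (hkn : k ≤ n+1) {p : Equiv.Perm (Fin (2*n+2))}
    (hp : p ∈ WP n k) : IsSigned n p ∧ ∀ x, ((p x : ℕ) < k ↔ (x:ℕ) < k) := by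
  unfold WP at hp
  induction hp using Subgroup.closure_induction with
  | mem x hx =>
    obtain ⟨i, hi, rfl⟩ := hx
    refine ⟨sgen_signed n i, fun x => ?_⟩
    have := i.isLt
    have := x.isLt
    rw [sgen_val]
    split_ifs <;> omega
  | one => exact ⟨signed_one n, fun x => Iff.rfl⟩
  | mul x y _ _ hx hy =>
    refine ⟨signed_mul hx.1 hy.1, fun z => ?_⟩
    rw [Equiv.Perm.mul_apply, hx.2, hy.2]
  | inv x _ hx =>
    refine ⟨fun i => ?_, fun z => ?_⟩
    · rw [Equiv.Perm.inv_eq_iff_eq, hx.1]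
      simp
    · rw [← hx.2]
      simp

lemma minrep_of_asc {n k : ℕ} (hk : 2 ≤ k) (hkn : k ≤ n+1) {w : Equiv.Perm (Fin (2*n+2))}
    (hw : IsSigned n w) (h : ∀ i : Fin (n+1), (i:ℕ) ≠ k - 1 → Asc n w i) : IsMinRep n k w := by
  intro p hp
  have hps := WP_spec hk hkn hp
  have hpi := WP_spec hk hkn ((WP n k).inv_mem hp)
  suffices LL n w ≤ LL n (w * p) by
    have h2 := len_eq hw
    have h3 := len_eq (signed_mul hw hps.1)
    omega
  have key : ∀ x y : Fin (2*n+2), x < y → w y < w x → p⁻¹ x < p⁻¹ y := by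
    intro x y hxy hyx
    have hwall : ((x:ℕ) < k ∧ k ≤ (y:ℕ)) ∨ ((x:ℕ) < 2*n+2-k ∧ 2*n+2-k ≤ (y:ℕ)) := by
      by_contra hc
      refine absurd hyx (not_lt_of_gt ?_)
      refine mono_of_asc (fun i => i ≠ k-1 ∧ 2*n - i ≠ k - 1) ?_ x y hxy ?_
      · intro i hi ⟨h1, h2⟩
        exact asc_all hw (k-1) h i hi h1 h2
      · intro i h1 h2
        have := y.isLt
        omega
    have hx1 := hpi.2 x
    have hx2 := hpi.2 (bar n x)
    have hy1 := hpi.2 y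
    have hy2 := hpi.2 (bar n y)
    rw [hpi.1, bar_val, bar_val] at hx2 hy2
    have := x.isLt
    have := y.isLt
    have := (p⁻¹ x).isLt
    have := (p⁻¹ y).isLt
    rw [Fin.lt_def]
    omega
  unfold LL
  apply Nat.add_le_add
  · refine card_le_card_of_injOn (fun x => (p⁻¹ x.1, p⁻¹ x.2)) ?_ ?_
    · intro x hx
      simp only [InvS, coe_filter, mem_univ, true_and, Set.mem_ofPred_eq] at hx ⊢
      refine ⟨key _ _ hx.1 hx.2, ?_⟩
      simpa using hx.2
    · intro x _ y _ hxy
      simpa [Prod.ext_iff] using hxy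
  · refine card_le_card_of_injOn (fun x => p⁻¹ x) ?_ ?_
    · intro x hx
      simp only [NegS, coe_filter, mem_univ, true_and, Set.mem_ofPred_eq] at hx ⊢
      rw [← hpi.1]
      refine ⟨key _ _ hx.1 hx.2, ?_⟩
      simpa using hx.2
    · intro x _ y _ hxy
      simpa using hxy

lemma sgen_mem_WP {n k : ℕ} (i : Fin (n+1)) (hi : (i:ℕ) ≠ k - 1) : sgen n i ∈ WP n k :=
  Subgroup.subset_closure ⟨i, hi, rfl⟩

lemma asc_of_minrep {n k : ℕ} {w : Equiv.Perm (Fin (2*n+2))}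
    (hw : IsSigned n w) (h : IsMinRep n k w) (i : Fin (n+1)) (hi : (i:ℕ) ≠ k - 1) :
    Asc n w i := by
  by_contra hc
  have := len_desc hw i hc
  have := h _ (sgen_mem_WP i hi)
  omega

lemma cosetLen_le {n k : ℕ} (w : Equiv.Perm (Fin (2*n+2))) (p) (hp : p ∈ WP n k) :
    cosetLen n k w ≤ len n (w * p) := Nat.sInf_le ⟨p, hp, rfl⟩

lemma cosetLen_of_minrep {n k : ℕ} {w : Equiv.Perm (Fin (2*n+2))} (h : IsMinRep n k w) :
    cosetLen n k w = len n w := by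
  apply le_antisymm
  · simpa using cosetLen_le w 1 (WP n k).one_mem
  · obtain ⟨p, hp, e⟩ : cosetLen n k w ∈ {m | ∃ p ∈ WP n k, len n (w * p) = m} :=
      Nat.sInf_mem ⟨_, 1, (WP n k).one_mem, rfl⟩
    rw [← e]; exact h p hp

lemma cosetLen_mul {n k : ℕ} (w q : Equiv.Perm (Fin (2*n+2))) (hq : q ∈ WP n k) :
    cosetLen n k (w * q) = cosetLen n k w := by
  unfold cosetLen
  congr 1
  ext m
  constructor
  · rintro ⟨p, hp, e⟩
    exact ⟨q * p, (WP n k).mul_mem hq hp, by rw [← mul_assoc, e]⟩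
  · rintro ⟨p, hp, e⟩
    exact ⟨q⁻¹ * p, (WP n k).mul_mem ((WP n k).inv_mem hq) hp, by
      rw [← mul_assoc, mul_assoc w, mul_inv_cancel, mul_one, e]⟩

/-- index of the simple reflection used at step `j` -/
def stp (n j : ℕ) : Fin (n+1) := ⟨min j (2*n - j), by omega⟩

def cc (n : ℕ) : ℕ → Equiv.Perm (Fin (2*n+2))
  | 0 => 1
  | j+1 => cc n j * sgen n (stp n j)

lemma cc_signed (n j : ℕ) : IsSigned n (cc n j) := by
  induction j with
  | zero => exact signed_one n
  | succ j ih => exact signed_mul ih (sgen_signed n _)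

set_option maxHeartbeats 1000000 in
lemma cc_val (n j : ℕ) (hj : j ≤ 2*n+1) (p : Fin (2*n+2)) :
    (cc n j p : ℕ) = if (p:ℕ) = j then 0 else if (p:ℕ) = 2*n+1-j then 2*n+1 else
      if (p:ℕ) < j ∧ (p:ℕ) < 2*n+1-j then p+1 else if j < (p:ℕ) ∧ 2*n+1-j < (p:ℕ) then p-1
      else p := by
  have hp := p.isLt
  induction j generalizing p with
  | zero =>
    simp only [cc, Equiv.Perm.one_apply]
    split_ifs <;> omega
  | succ j ih =>
    simp only [cc, Equiv.Perm.mul_apply]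
    have h1 := sgen_val n (stp n j) p
    have h2 := ih (by omega) (sgen n (stp n j) p) (Fin.isLt _)
    generalize sgen n (stp n j) p = q at h1 h2 ⊢
    rw [h2]
    clear h2 ih
    have : (stp n j : ℕ) = min j (2*n-j) := rfl
    rcases le_total j (2*n-j) with h | h
    · rw [min_eq_left h] at this
      rw [this] at h1
      split_ifs at h1 <;> split_ifs <;> omega
    · rw [min_eq_right h] at this
      rw [this] at h1
      split_ifs at h1 <;> split_ifs <;> omega

lemma cc_last (n : ℕ) : cc n (2*n+1) = s2t1 n := by
  ext p
  have hp := p.isLt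
  rw [cc_val n _ le_rfl]
  simp only [s2t1, Equiv.swap_apply_def, Fin.ext_iff]
  split_ifs <;> first | omega | (dsimp only; done) | (dsimp only; omega)

/-- the ascent condition at step `j`. -/
lemma asc_step {n : ℕ} {u : Equiv.Perm (Fin (2*n+2))} (hu : IsSigned n u) {j : ℕ}
    (hj : j ≤ 2*n) : Asc n u (stp n j) ↔ Asc n u j := by
  have : (stp n j : ℕ) = min j (2*n-j) := rfl
  rcases le_total j (2*n-j) with h | h
  · rw [min_eq_left h] at this
    rw [this]
  · rw [min_eq_right h] at this
    rw [this]
    constructor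
    · intro h'
      have := asc_bar hu (by omega) h'
      rwa [show 2*n - (2*n - j) = j by omega] at this
    · exact asc_bar hu hj

lemma asc_zero {n : ℕ} {w : Equiv.Perm (Fin (2*n+2))} 
    (h0 : w (z0 n) = (z0 n)) {j : ℕ} (hj : j ≤ 2*n) : Asc n (w * cc n j) j := by
  intro p q hp hq
  have e : cc n j p = (z0 n) := by
    ext; rw [cc_val n j (by omega), if_pos hp, z0_val]
  rw [Equiv.Perm.mul_apply, e, h0]
  rw [Fin.lt_def]
  apply Nat.pos_of_ne_zero
  intro hc
  have h1 : (w * cc n j) q = (w * cc n j) p := by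
    rw [Equiv.Perm.mul_apply, Equiv.Perm.mul_apply, e, h0]
    exact Fin.ext hc
  have := (w * cc n j).injective h1
  rw [this] at hq
  omega

lemma len_zero {n : ℕ} {w : Equiv.Perm (Fin (2*n+2))} (hw : IsSigned n w)
    (h0 : w (z0 n) = (z0 n)) {j : ℕ} (hj : j ≤ 2*n+1) :
    len n (w * cc n j) = len n w + j := by
  induction j with
  | zero => simp [cc]
  | succ j ih =>
    have hs := signed_mul hw (cc_signed n j)
    rw [cc, ← mul_assoc, len_asc hs _ ((asc_step hs (by omega)).2 (asc_zero h0 (by omega))),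
      ih (by omega)]
    omega

lemma minrep_zero {n k : ℕ} (hk : 2 ≤ k) (hkn : k ≤ n+1) {w : Equiv.Perm (Fin (2*n+2))}
    (hw : IsSigned n w) (hmin : IsMinRep n k w)
    (h0 : w (z0 n) = (z0 n)) : IsMinRep n k (w * cc n (2*n+2-k)) := by
  apply minrep_of_asc hk hkn (signed_mul hw (cc_signed n _))
  intro i hi p q hp hq
  have hin := i.isLt
  have hA := asc_of_minrep hw hmin
  rw [Equiv.Perm.mul_apply, Equiv.Perm.mul_apply]
  have hcp := cc_val n (2*n+2-k) (by omega) p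
  have hcq := cc_val n (2*n+2-k) (by omega) q
  by_cases h1 : (i:ℕ) + 1 = k - 1
  · have e : cc n (2*n+2-k) q = bar n (z0 n) := by
      ext; rw [hcq, bar_val, z0_val]
      split_ifs <;> omega
    have hne : cc n (2*n+2-k) p ≠ cc n (2*n+2-k) q := by
      intro hc
      have := (cc n (2*n+2-k)).injective hc
      rw [this] at hp
      omega
    have hne2 := fun hc => hne (w.injective hc)
    rw [e, hw, h0] at hne2 ⊢
    have := (w (cc n (2*n+2-k) p)).isLt
    rw [Fin.ext_iff, bar_val] at hne2
    rw [Fin.lt_def, bar_val]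
    clear hcp hcq hne e
    change ¬ (_ = 2*n+1-0) at hne2
    change _ < 2*n+1-0
    omega
  · by_cases h2 : (i:ℕ) + 1 < k - 1
    · refine hA ⟨i+1, by omega⟩ (by simp only; omega) _ _ ?_ ?_
      · rw [hcp]; simp only; split_ifs <;> omega
      · rw [hcq]; simp only; split_ifs <;> omega
    · refine hA i hi _ _ ?_ ?_
      · rw [hcp]; split_ifs <;> omega
      · rw [hcq]; split_ifs <;> omega

lemma zero_of {n k : ℕ} (hk : 2 ≤ k) (hkn : k ≤ n+1) {w : Equiv.Perm (Fin (2*n+2))}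
    (hw : IsSigned n w) 
    (hasc : ∀ j < 2*n+2-k, Asc n (w * cc n j) j)
    (hmin : IsMinRep n k (w * cc n (2*n+2-k))) : 
    w (z0 n) = (z0 n) := by
  have hus := signed_mul hw (cc_signed n (2*n+2-k))
  have hA := asc_of_minrep hus hmin
  have hval : ∀ j (hj : j ≤ 2*n+1) (p : Fin (2*n+2)), (p:ℕ) = j → cc n j p = (z0 n) := by
    intro j hj p hp
    ext
    rw [cc_val n j hj, if_pos hp, z0_val]
  have hall : ∀ q : Fin (2*n+2), (q:ℕ) ≠ 0 → w (z0 n) < w q := by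
    intro q hq
    have hql := q.isLt
    -- via an ascent step
    have step : ∀ (j : ℕ) (hj : j < 2*n+2-k) (hc : cc n j ⟨j+1, by omega⟩ = q),
        w (z0 n) < w q := by
      intro j hj hc
      have := hasc j hj ⟨j, by omega⟩ ⟨j+1, by omega⟩ rfl rfl
      rwa [Equiv.Perm.mul_apply, Equiv.Perm.mul_apply, hc, hval j (by omega) _ rfl] at this
    by_cases h1 : (q:ℕ) ≤ n
    · refine step (q-1) (by omega) ?_
      ext; rw [cc_val n _ (by omega)]; simp only; split_ifs <;> omega
    by_cases h2 : (q:ℕ) = 2*n+1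
    · refine step n (by omega) ?_
      ext; rw [cc_val n _ (by omega)]; simp only; split_ifs <;> omega
    by_cases h3 : (q:ℕ) < 2*n+2-k
    · refine step q (by omega) ?_
      ext; rw [cc_val n _ (by omega)]; simp only; split_ifs <;> omega
    · have := mono_of_asc (w := w * cc n (2*n+2-k)) (fun i => i ≠ k-1 ∧ 2*n-i ≠ k-1)
        (fun i hi hP => asc_all hus (k-1) hA i hi hP.1 hP.2)
        ⟨2*n+2-k, by omega⟩ ⟨q+1, by omega⟩ (by rw [Fin.lt_def]; simp only; omega)
        (by intro i h1 h2; simp only at h1 h2; omega)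
      rw [Equiv.Perm.mul_apply, Equiv.Perm.mul_apply, hval (2*n+2-k) (by omega) _ rfl] at this
      convert this using 2
      ext; rw [cc_val n _ (by omega)]; simp only; split_ifs <;> omega
  obtain ⟨q, hq⟩ := w.surjective (z0 n)
  by_cases h : (q:ℕ) = 0
  · have : q = (z0 n) := Fin.ext h
    exact (congrArg w this.symm).trans hq
  · have := hall q h
    rw [hq, Fin.lt_def, z0_val] at this
    omega

end

/-- For `w ∈ W^{P_k}` (type `C_{n+1}`, `1 < k ≤ n+1`), with `z_1 W_{P_k} = s_{2t_1} W_{P_k}`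
and `·` the Hecke product, one has `ℓ(w · z_1 W_{P_k}) = ℓ(w) + ℓ(z_1 W_{P_k})` if and only
if `w(1) = 1`. -/
theorem stmt3 (n k : ℕ) (hk : 2 ≤ k) (hkn : k ≤ n+1)
    (h : Equiv.Perm (Fin (2*n+2)) → Equiv.Perm (Fin (2*n+2)) → Equiv.Perm (Fin (2*n+2)))
    (hclosed : ∀ a b, IsSigned n a → IsSigned n b → IsSigned n (h a b))
    (hassoc : ∀ a b c, IsSigned n a → IsSigned n b → IsSigned n c →
      h (h a b) c = h a (h b c))
    (hone : ∀ a, IsSigned n a → h a 1 = a)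
    (hsimp : ∀ w i, IsSigned n w →
      h w (sgen n i) = if len n w < len n (w * sgen n i) then w * sgen n i else w)
    (w : Equiv.Perm (Fin (2*n+2))) (hw : IsSigned n w) (hmin : IsMinRep n k w) :
    cosetLen n k (h w (s2t1 n)) = len n w + cosetLen n k (s2t1 n) ↔
      w ⟨0, by omega⟩ = ⟨0, by omega⟩ := by
  have hS : ∀ j, IsSigned n (h w (cc n j)) := fun j => hclosed _ _ hw (cc_signed n j)
  have hup : ∀ u i, IsSigned n u → Asc n u (i : Fin (n+1)) → h u (sgen n i) = u * sgen n i := by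
    intro u i hu ha
    rw [hsimp u i hu, if_pos (by rw [len_asc hu i ha]; omega)]
  have hdn : ∀ u i, IsSigned n u → ¬ Asc n u (i : Fin (n+1)) → h u (sgen n i) = u := by
    intro u i hu ha
    rw [hsimp u i hu, if_neg (by have := len_desc hu i ha; omega)]
  have hstep : ∀ j, j ≤ 2*n → h w (cc n (j+1)) = h (h w (cc n j)) (sgen n (stp n j)) := by
    intro j hj
    rw [hassoc _ _ _ hw (cc_signed n j) (sgen_signed n _), hup _ _ (cc_signed n j), cc]
    rw [asc_step (cc_signed n j) hj]
    have := asc_zero (n := n) (w := 1) rfl hj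
    rwa [one_mul] at this
  have h1min : IsMinRep n k 1 := by
    apply minrep_of_asc hk hkn (signed_one n)
    intro i _ p q hp hq
    rw [Equiv.Perm.one_apply, Equiv.Perm.one_apply, Fin.lt_def]
    omega
  -- coset lengths stabilise from step `2n+2-k` on
  have hstab : ∀ d, 2*n+2-k + d ≤ 2*n+1 →
      cosetLen n k (h w (cc n (2*n+2-k+d))) = cosetLen n k (h w (cc n (2*n+2-k))) ∧
      cosetLen n k (cc n (2*n+2-k+d)) = cosetLen n k (cc n (2*n+2-k)) := by
    intro d
    induction d with
    | zero => intro _; exact ⟨rfl, rfl⟩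
    | succ d ih =>
      intro hd
      obtain ⟨i1, i2⟩ := ih (by omega)
      have hm : sgen n (stp n (2*n+2-k+d)) ∈ WP n k := by
        apply sgen_mem_WP
        simp only [stp]
        omega
      rw [← add_assoc]
      constructor
      · rw [hstep _ (by omega), ← i1]
        by_cases ha : Asc n (h w (cc n (2*n+2-k+d))) (stp n (2*n+2-k+d))
        · rw [hup _ _ (hS _) ha, cosetLen_mul _ _ hm]
        · rw [hdn _ _ (hS _) ha]
      · rw [cc, cosetLen_mul _ _ hm, i2]
  have hfin := hstab (k-1) (by omega)
  rw [show 2*n+2-k+(k-1) = 2*n+1 by omega, cc_last] at hfin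
  have hz : cosetLen n k (cc n (2*n+2-k)) = 2*n+2-k := by
    have m1 := minrep_zero hk hkn (signed_one n) h1min rfl
    have l1 := len_zero (signed_one n) rfl (show 2*n+2-k ≤ 2*n+1 by omega)
    have l0 := len_eq (signed_one n)
    rw [LL_one] at l0
    rw [← cosetLen_of_minrep m1, one_mul] at l1
    omega
  rw [hfin.1, hfin.2, hz]
  have hrec : ∀ j, j ≤ 2*n+1 → len n (h w (cc n j)) ≤ len n w + j ∧
      (len n (h w (cc n j)) = len n w + j →
        h w (cc n j) = w * cc n j ∧ ∀ i < j, Asc n (w * cc n i) i) := by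
    intro j
    induction j with
    | zero =>
      intro _
      rw [cc, hone w hw]
      simp
    | succ j ih =>
      intro hj
      obtain ⟨i1, i2⟩ := ih (by omega)
      rw [hstep j (by omega)]
      by_cases ha : Asc n (h w (cc n j)) (stp n j)
      · rw [hup _ _ (hS _) ha, len_asc (hS _) _ ha]
        refine ⟨by omega, fun e => ?_⟩
        obtain ⟨e1, e2⟩ := i2 (by omega)
        rw [e1] at ha ⊢
        refine ⟨by rw [cc, mul_assoc], ?_⟩
        intro i hi
        rcases Nat.lt_succ_iff_lt_or_eq.1 hi with h' | h'
        · exact e2 i h'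
        · subst h'
          exact (asc_step (signed_mul hw (cc_signed n i)) (by omega)).1 ha
      · rw [hdn _ _ (hS _) ha]
        exact ⟨by omega, fun e => by omega⟩
  constructor
  · intro he
    have hle : cosetLen n k (h w (cc n (2*n+2-k))) ≤ len n (h w (cc n (2*n+2-k))) := by
      simpa using cosetLen_le (h w (cc n (2*n+2-k))) 1 (WP n k).one_mem
    obtain ⟨r1, r2⟩ := hrec (2*n+2-k) (by omega)
    obtain ⟨e1, e2⟩ := r2 (by omega)
    refine zero_of hk hkn hw e2 ?_
    rw [← e1]
    intro p hp
    have := cosetLen_le (h w (cc n (2*n+2-k))) p hp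
    omega
  · intro h0
    have hj : ∀ j, j ≤ 2*n+1 → h w (cc n j) = w * cc n j := by
      intro j
      induction j with
      | zero => intro _; rw [cc, hone w hw, mul_one]
      | succ j ih =>
        intro hj
        have hs := signed_mul hw (cc_signed n j)
        rw [hstep j (by omega), ih (by omega), hup _ _ hs, cc, mul_assoc]
        exact (asc_step hs (by omega)).2 (asc_zero h0 (by omega))
    rw [hj _ (by omega), cosetLen_of_minrep (minrep_zero hk hkn hw hmin h0),
      len_zero hw h0 (by omega)]
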